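/- Let (t, x) ↦ φ_t(x) and (t, x) ↦ F_t(x) be C² on [0, 1] × ℝ^{2n}, with each φ_t a diffeomorphism of ℝ^{2n} satisfying Dφ_t(x) ∈ Sp(n, ℝ) for all x, and each F_t a generating function of φ_t, i.e. D_xF_t(x)y = (1/2)ω(φ_t(x), Dφ_t(x)y) − (1/2)ω(x, y) for all x, y. Suppose moreover that for every x the curve t ↦ (φ_t(x), x̄ + F_t(x)) in H(n) is horizontal, i.e. ∂_t F_t(x) = (1/2)ω(φ_t(x), ∂_tφ_t(x)) for all t, x. Then ∂_tφ_t(x) = 0 for all t and x, i.e. the flow t ↦ φ̃_t(x, x̄) = (φ_t(x), x̄ + F_t(x)) is constant in t. -/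

import Mathlib

open MeasureTheory Set Function
open scoped BigOperators Topology

noncomputable section

/-- `ℝ^{2n}` with the Euclidean norm. -/
abbrev E (n : ℕ) := EuclideanSpace ℝ (Fin n ⊕ Fin n)

/-- The standard symplectic form `ω(x,y) = ⟨Jx, y⟩` on `ℝ^{2n}`. -/
def symp {n : ℕ} (x y : E n) : ℝ :=
  ∑ i : Fin n, (x (Sum.inl i) * y (Sum.inr i) - x (Sum.inr i) * y (Sum.inl i))

theorem symp_add_left {n : ℕ} (x x' y : E n) : symp (x + x') y = symp x y + symp x' y := by
  simp only [symp, ← Finset.sum_add_distrib, PiLp.add_apply]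
  exact Finset.sum_congr rfl fun _ _ => by ring

theorem symp_smul_left {n : ℕ} (c : ℝ) (x y : E n) : symp (c • x) y = c * symp x y := by
  simp only [symp, Finset.mul_sum, PiLp.smul_apply, smul_eq_mul]
  exact Finset.sum_congr rfl fun _ _ => by ring

theorem symp_swap {n : ℕ} (x y : E n) : symp x y = -symp y x := by
  simp only [symp, ← Finset.sum_neg_distrib]
  exact Finset.sum_congr rfl fun _ _ => by ring

theorem symp_add_right {n : ℕ} (x y y' : E n) : symp x (y + y') = symp x y + symp x y' := by
  rw [symp_swap, symp_add_left, symp_swap x y, symp_swap x y']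
  ring

theorem symp_smul_right {n : ℕ} (c : ℝ) (x y : E n) : symp x (c • y) = c * symp x y := by
  rw [symp_swap, symp_smul_left, symp_swap x y]
  ring

/-- The standard symplectic form as a continuous bilinear map. -/
def sympCLM (n : ℕ) : E n →L[ℝ] E n →L[ℝ] ℝ :=
  (LinearMap.mk₂ ℝ symp symp_add_left symp_smul_left symp_add_right
    symp_smul_right).toContinuousBilinearMap

@[simp]
theorem sympCLM_apply {n : ℕ} (x y : E n) : sympCLM n x y = symp x y := rfl

theorem eq_zero_of_forall_symp_eq_zero {n : ℕ} {x : E n} (h : ∀ y, symp x y = 0) : x = 0 := by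
  ext (i | i)
  · simpa [symp, Pi.single_apply] using h (EuclideanSpace.single (Sum.inr i) 1)
  · simpa [symp, Pi.single_apply] using h (EuclideanSpace.single (Sum.inl i) 1)

theorem surjective_of_symp_map {n : ℕ} (A : E n →L[ℝ] E n)
    (hA : ∀ y z, symp (A y) (A z) = symp y z) : Function.Surjective A := by
  refine (LinearMap.injective_iff_surjective (f := (A : E n →ₗ[ℝ] E n))).1 ?_
  refine (injective_iff_map_eq_zero _).2 fun y hy => eq_zero_of_forall_symp_eq_zero fun z => ?_
  have hy' : A y = 0 := hy
  rw [← hA, hy', ← sympCLM_apply, map_zero, zero_apply]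

/-- If `dG = ½ ω(Φ, dΦ) - ½ ω(x, dx)` near `p`, then `Φ` pulls `ω` back to `ω(dx, dx)` at `p`. -/
theorem symp_fderiv_of_primitive {n : ℕ} {Φ : ℝ × E n → E n} {G : ℝ × E n → ℝ} {p : ℝ × E n}
    (hΦ : ContDiff ℝ 2 Φ) (hG : ContDiff ℝ 2 G)
    (h : ∀ᶠ q in 𝓝 p, ∀ u : ℝ × E n,
      fderiv ℝ G q u = (1/2) * symp (Φ q) (fderiv ℝ Φ q u) - (1/2) * symp q.2 u.2)
    (w u : ℝ × E n) :
    symp (fderiv ℝ Φ p w) (fderiv ℝ Φ p u) = symp w.2 u.2 := by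
  have hdΦ := ((hΦ.fderiv_right (m := 1) (by norm_num)).differentiable one_ne_zero p).hasFDerivAt
  have hdG := ((hG.fderiv_right (m := 1) (by norm_num)).differentiable one_ne_zero p).hasFDerivAt
  have hΦ₁ := (hΦ.differentiable two_ne_zero p).hasFDerivAt
  have second (w u : ℝ × E n) : fderiv ℝ (fderiv ℝ G) p w u
      = (1/2) * (symp (Φ p) (fderiv ℝ (fderiv ℝ Φ) p w u)
        + symp (fderiv ℝ Φ p w) (fderiv ℝ Φ p u)) - (1/2) * symp w.2 u.2 := by
    have h₁ := hdG.clm_apply (hasFDerivAt_const u p)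
    have h₂ := (((sympCLM n).hasFDerivAt_of_bilinear hΦ₁
      (hdΦ.clm_apply (hasFDerivAt_const u p))).const_mul (1/2 : ℝ)).sub
      (((sympCLM n).hasFDerivAt_of_bilinear (hasFDerivAt_snd (𝕜 := ℝ) (p := p))
        (hasFDerivAt_const u.2 p)).const_mul (1/2 : ℝ))
    have h₃ := h₁.unique (h₂.congr_of_eventuallyEq (h.mono fun q hq => hq u))
    simpa [mul_add] using DFunLike.congr_fun h₃ w
  have symΦ := (hΦ.contDiffAt (x := p)).isSymmSndFDerivAt (by simp) w u
  have symG := (hG.contDiffAt (x := p)).isSymmSndFDerivAt (by simp) w u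
  rw [second w u, second u w, symΦ, symp_swap (fderiv ℝ Φ p u), symp_swap u.2] at symG
  linarith

theorem fderiv_uncurry_inl {V W : Type*} [NormedAddCommGroup V] [NormedSpace ℝ V]
    [NormedAddCommGroup W] [NormedSpace ℝ W] {f : ℝ → V → W} {t : ℝ} {x : V}
    (hf : DifferentiableAt ℝ (Function.uncurry f) (t, x)) :
    fderiv ℝ (Function.uncurry f) (t, x) (1, 0) = deriv (fun s => f s x) t :=
  (hf.hasFDerivAt.comp_hasDerivAt t
    ((hasDerivAt_id t).prodMk (hasDerivAt_const t x))).deriv.symm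

theorem fderiv_uncurry_inr {V W : Type*} [NormedAddCommGroup V] [NormedSpace ℝ V]
    [NormedAddCommGroup W] [NormedSpace ℝ W] {f : ℝ → V → W} {t : ℝ} {x : V}
    (hf : DifferentiableAt ℝ (Function.uncurry f) (t, x)) (y : V) :
    fderiv ℝ (Function.uncurry f) (t, x) (0, y) = fderiv ℝ (f t) x y := by
  have h := (hf.hasFDerivAt.comp x (hasFDerivAt_prodMk_right t x)).fderiv
  exact (DFunLike.congr_fun h y).symm

/-- There are no non-constant horizontal flows of lifted symplectomorphisms of
`H(n)`: if each curve `t ↦ (φ_t(x), x̄ + F_t(x))` is horizontal, the flow is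
constant. -/
theorem no_nonconstant_horizontal_flows
    (n : ℕ) (φ : ℝ → E n → E n) (F : ℝ → E n → ℝ)
    (hφC2 : ContDiff ℝ 2 (Function.uncurry φ))
    (hFC2 : ContDiff ℝ 2 (Function.uncurry F))
    (hφbij : ∀ t ∈ Icc (0:ℝ) 1, Function.Bijective (φ t))
    (hSp : ∀ t ∈ Icc (0:ℝ) 1, ∀ (x y z : E n),
      symp (fderiv ℝ (φ t) x y) (fderiv ℝ (φ t) x z) = symp y z)
    (hFgen : ∀ t ∈ Icc (0:ℝ) 1, ∀ (x y : E n),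
      fderiv ℝ (F t) x y
        = (1/2) * symp (φ t x) (fderiv ℝ (φ t) x y) - (1/2) * symp x y)
    (hhor : ∀ t ∈ Icc (0:ℝ) 1, ∀ x : E n,
      deriv (fun s : ℝ => F s x) t
        = (1/2) * symp (φ t x) (deriv (fun s : ℝ => φ s x) t)) :
    ∀ t ∈ Icc (0:ℝ) 1, ∀ x : E n, deriv (fun s : ℝ => φ s x) t = 0 := by
  have hφd := hφC2.differentiable two_ne_zero
  have hFd := hFC2.differentiable two_ne_zero
  have interior : ∀ t ∈ Ioo (0:ℝ) 1, ∀ x : E n, deriv (fun s : ℝ => φ s x) t = 0 := by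
    intro t ht x
    have hprim : ∀ᶠ q in 𝓝 (t, x), ∀ u : ℝ × E n,
        fderiv ℝ (Function.uncurry F) q u
          = (1/2) * symp (Function.uncurry φ q) (fderiv ℝ (Function.uncurry φ) q u)
            - (1/2) * symp q.2 u.2 := by
      filter_upwards [continuousAt_fst.eventually (isOpen_Ioo.mem_nhds ht)]
      rintro ⟨s, y⟩ hs ⟨a, b⟩
      have hs' : s ∈ Icc (0:ℝ) 1 := Ioo_subset_Icc_self hs
      have hab : ((a, b) : ℝ × E n) = a • (1, 0) + (0, b) := by simp
      rw [hab, map_add, map_add, map_smul, map_smul, fderiv_uncurry_inl (hFd _),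
        fderiv_uncurry_inl (hφd _), fderiv_uncurry_inr (hFd _), fderiv_uncurry_inr (hφd _),
        hFgen s hs', hhor s hs', symp_add_right, symp_smul_right]
      simp
      ring
    refine eq_zero_of_forall_symp_eq_zero fun z => ?_
    obtain ⟨y, rfl⟩ := surjective_of_symp_map _ (hSp t (Ioo_subset_Icc_self ht) x) z
    have key := symp_fderiv_of_primitive hφC2 hFC2 hprim (1, 0) (0, y)
    rw [fderiv_uncurry_inl (hφd _), fderiv_uncurry_inr (hφd _)] at key
    simpa [symp] using key
  intro t ht x
  have hcont : Continuous fun s : ℝ => deriv (fun r : ℝ => φ r x) s :=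
    (hφC2.comp (contDiff_id.prodMk contDiff_const)).continuous_deriv (by norm_num)
  rw [← closure_Ioo zero_ne_one] at ht
  exact closure_minimal (fun s hs => interior s hs x)
    (isClosed_eq hcont continuous_const) ht
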